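/- Let d ≥ 1, let n_1,…,n_d be positive integers and let m̃ > 0. Then Σ_{λ ∈ Λ^{m̃}_{DT_d(N)}} log λ = V_d^{d,N} · ℒ_{m̃}(0) + ℋ_N(0), where V_d^{d,N} = ∏_{i=1}^d n_i, ℒ_{m̃}(0) = −∫₀^∞ (e^{−m̃²t} e^{−2dt} I₀(2t)^d − e^{−t}) dt/t, and ℋ_N(0) = −∫₀^∞ (Θ^{m̃}_{DT_d(N)}(t) − V_d^{d,N} e^{−m̃²t} e^{−2dt} I₀(2t)^d) dt/t, both integrals being absolutely convergent. -/

import Mathlib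

open Real Filter Finset MeasureTheory

/-- The modified Bessel function of the first kind of order zero. -/
noncomputable def besselI0 (x : ℝ) : ℝ :=
  (1 / Real.pi) * ∫ θ in (0:ℝ)..Real.pi, Real.exp (x * Real.cos θ)

/-- Eigenvalues of the massive discrete Laplacian on the discrete torus `DT_d(N)`. -/
noncomputable def lamDT (d : ℕ) (n : Fin d → ℕ) (mt : ℝ) (q : ∀ i : Fin d, Fin (n i)) : ℝ :=
  2 * (d : ℝ) + mt ^ 2 - 2 * ∑ i, Real.cos (2 * Real.pi * ((q i : ℕ) : ℝ) / (n i : ℝ))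

/-- Theta function of the massive discrete Laplacian on the discrete torus `DT_d(N)`. -/
noncomputable def ThetaDTm (d : ℕ) (n : Fin d → ℕ) (mt : ℝ) (t : ℝ) : ℝ :=
  ∑ q : (∀ i : Fin d, Fin (n i)), Real.exp (-lamDT d n mt q * t)

lemma aux_integrable_le {a b : ℝ} (ha : 0 < a) (hab : a ≤ b) :
    IntegrableOn (fun t : ℝ => (Real.exp (-a * t) - Real.exp (-b * t)) / t) (Set.Ioi 0) := by
  have h := (exp_neg_integrableOn_Ioi 0 ha).const_mul (b - a)
  refine Integrable.mono' h ?_ ?_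
  · exact (by fun_prop : Measurable _).aestronglyMeasurable
  · refine (ae_restrict_iff' measurableSet_Ioi).2 (Eventually.of_forall fun t ht => ?_)
    have ht : 0 < t := ht
    have h1 : Real.exp (-b * t) = Real.exp (-a * t) * Real.exp (-(b - a) * t) := by
      rw [← Real.exp_add]; congr 1; ring
    have h2 := Real.add_one_le_exp (-(b - a) * t)
    have h3 : Real.exp (-b * t) ≤ Real.exp (-a * t) :=
      Real.exp_le_exp.2 (by nlinarith)
    rw [Real.norm_of_nonneg (div_nonneg (by linarith) ht.le), div_le_iff₀ ht, h1]
    nlinarith [Real.exp_pos (-a * t)]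

lemma aux_integrable {a b : ℝ} (ha : 0 < a) (hb : 0 < b) :
    IntegrableOn (fun t : ℝ => (Real.exp (-a * t) - Real.exp (-b * t)) / t) (Set.Ioi 0) := by
  rcases le_total a b with h | h
  · exact aux_integrable_le ha h
  · have := (aux_integrable_le hb h).neg
    refine this.congr (Eventually.of_forall fun t => ?_)
    simp only [Pi.neg_apply]
    ring

lemma aux_frullani {a : ℝ} (ha : 0 < a) :
    ∫ t in Set.Ioi (0:ℝ), (Real.exp (-a * t) - Real.exp (-t)) / t = - Real.log a := by
  have hi := aux_integrable ha one_pos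
  have hc : Continuous fun x : ℝ => Real.exp (-x) := by fun_prop
  have h0 := hc.tendsto 0
  simp only [neg_zero, Real.exp_zero] at h0
  have e : (fun x : ℝ => x⁻¹ • (Real.exp (-(a * x)) - Real.exp (-(1 * x)))) =
      fun t : ℝ => (Real.exp (-a * t) - Real.exp (-1 * t)) / t := by
    funext t
    simp only [smul_eq_mul, neg_mul]
    ring
  have := Frullani.integral_Ioi_eq (f := fun x : ℝ => Real.exp (-x)) (L := 1) (R := 0) (a := a)
    (b := 1) (hc.locallyIntegrable.locallyIntegrableOn _) ha one_pos
    (h0.mono_left nhdsWithin_le_nhds) Real.tendsto_exp_neg_atTop_nhds_zero (by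
      simp only [e]; exact hi)
  simp only [e] at this
  simpa using this

lemma besselI0_continuous : Continuous besselI0 := by
  unfold besselI0
  refine continuous_const.mul ?_
  apply intervalIntegral.continuous_parametric_intervalIntegral_of_continuous'
  simp only [Function.uncurry_def]
  fun_prop

lemma besselI0_le {x : ℝ} (hx : 0 ≤ x) : besselI0 x ≤ Real.exp x := by
  have h : ∫ θ in (0:ℝ)..Real.pi, Real.exp (x * Real.cos θ) ≤
      ∫ θ in (0:ℝ)..Real.pi, Real.exp x := by
    apply intervalIntegral.integral_mono Real.pi_pos.le
    · exact (by fun_prop : Continuous _).intervalIntegrable _ _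
    · exact (by fun_prop : Continuous _).intervalIntegrable _ _
    · intro θ
      exact Real.exp_le_exp.2 (by nlinarith [Real.cos_le_one θ])
  rw [intervalIntegral.integral_const, smul_eq_mul, sub_zero] at h
  unfold besselI0
  rw [one_div, inv_mul_le_iff₀ Real.pi_pos]
  exact h

lemma le_besselI0 {x : ℝ} (hx : 0 ≤ x) : Real.exp (-x) ≤ besselI0 x := by
  have h : ∫ θ in (0:ℝ)..Real.pi, Real.exp (-x) ≤
      ∫ θ in (0:ℝ)..Real.pi, Real.exp (x * Real.cos θ) := by
    apply intervalIntegral.integral_mono Real.pi_pos.le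
    · exact (by fun_prop : Continuous _).intervalIntegrable _ _
    · exact (by fun_prop : Continuous _).intervalIntegrable _ _
    · intro θ
      exact Real.exp_le_exp.2 (by nlinarith [Real.neg_one_le_cos θ])
  rw [intervalIntegral.integral_const, smul_eq_mul, sub_zero] at h
  unfold besselI0
  rw [one_div, le_inv_mul_iff₀ Real.pi_pos]
  exact h

lemma aux_L (d : ℕ) {mt : ℝ} (hmt : 0 < mt) :
    IntegrableOn (fun t : ℝ =>
      (Real.exp (-mt ^ 2 * t) * Real.exp (-2 * d * t) * (besselI0 (2 * t)) ^ d -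
        Real.exp (-t)) / t) (Set.Ioi 0) := by
  have hu := aux_integrable (a := mt ^ 2) (b := 1) (by positivity) one_pos
  have hl := aux_integrable (a := mt ^ 2 + 4 * d) (b := 1) (by positivity) one_pos
  refine Integrable.mono' (hu.norm.add hl.norm) ?_ ?_
  · have := besselI0_continuous.measurable
    exact (by fun_prop : Measurable _).aestronglyMeasurable
  · refine (ae_restrict_iff' measurableSet_Ioi).2 (Eventually.of_forall fun t ht => ?_)
    have ht : 0 < t := ht
    have h1 : besselI0 (2 * t) ^ d ≤ Real.exp (2 * d * t) := by
      calc besselI0 (2 * t) ^ d ≤ Real.exp (2 * t) ^ d :=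
            pow_le_pow_left₀ ((Real.exp_pos _).le.trans (le_besselI0 (by positivity)))
              (besselI0_le (by positivity)) d
        _ = _ := by rw [← Real.exp_nat_mul]; congr 1; ring
    have h2 : Real.exp (-2 * d * t) ≤ besselI0 (2 * t) ^ d := by
      calc _ = Real.exp (-(2 * t)) ^ d := by rw [← Real.exp_nat_mul]; congr 1; ring
        _ ≤ _ := pow_le_pow_left₀ (Real.exp_pos _).le (le_besselI0 (by positivity)) d
    set E := Real.exp (-mt ^ 2 * t) * Real.exp (-2 * d * t) with hE
    have hEp : 0 < E := by positivity
    have h3 : E * besselI0 (2 * t) ^ d ≤ Real.exp (-mt ^ 2 * t) := by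
      calc _ ≤ E * Real.exp (2 * d * t) := by gcongr
        _ = _ := by rw [hE, ← Real.exp_add, ← Real.exp_add]; congr 1; ring
    have h4 : Real.exp (-(mt ^ 2 + 4 * d) * t) ≤ E * besselI0 (2 * t) ^ d := by
      calc _ = E * Real.exp (-2 * d * t) := by
            rw [hE, ← Real.exp_add, ← Real.exp_add]; congr 1; ring
        _ ≤ _ := by gcongr
    simp only [Pi.add_apply, neg_one_mul, norm_div, ← add_div, Real.norm_of_nonneg ht.le]
    gcongr
    simp only [Real.norm_eq_abs]
    rw [abs_le]
    constructor
    · have := neg_abs_le (Real.exp (-(mt ^ 2 + 4 * d) * t) - Real.exp (-t))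
      have := abs_nonneg (Real.exp (-mt ^ 2 * t) - Real.exp (-t))
      linarith
    · have := le_abs_self (Real.exp (-mt ^ 2 * t) - Real.exp (-t))
      have := abs_nonneg (Real.exp (-(mt ^ 2 + 4 * d) * t) - Real.exp (-t))
      linarith

lemma lamDT_pos (d : ℕ) (n : Fin d → ℕ) {mt : ℝ} (hmt : 0 < mt) (q : ∀ i : Fin d, Fin (n i)) :
    0 < lamDT d n mt q := by
  have h : ∑ i, Real.cos (2 * Real.pi * ((q i : ℕ) : ℝ) / (n i : ℝ)) ≤ ∑ _i : Fin d, (1:ℝ) :=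
    Finset.sum_le_sum fun i _ => Real.cos_le_one _
  simp at h
  unfold lamDT
  nlinarith [pow_pos hmt 2]

theorem massive_torus_logdet_eq_L_add_H
    (d : ℕ) (hd : 1 ≤ d) (n : Fin d → ℕ) (hn : ∀ i, 0 < n i) (mt : ℝ) (hmt : 0 < mt) :
    IntegrableOn (fun t : ℝ =>
      (Real.exp (-mt ^ 2 * t) * Real.exp (-2 * d * t) * (besselI0 (2 * t)) ^ d -
        Real.exp (-t)) / t) (Set.Ioi 0) ∧
    IntegrableOn (fun t : ℝ =>
      (ThetaDTm d n mt t - (∏ i, (n i : ℝ)) * Real.exp (-mt ^ 2 * t) *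
        Real.exp (-2 * d * t) * (besselI0 (2 * t)) ^ d) / t) (Set.Ioi 0) ∧
    ∑ q : (∀ i : Fin d, Fin (n i)), Real.log (lamDT d n mt q) =
      (∏ i, (n i : ℝ)) *
        (-∫ t in Set.Ioi (0:ℝ),
          (Real.exp (-mt ^ 2 * t) * Real.exp (-2 * d * t) * (besselI0 (2 * t)) ^ d -
            Real.exp (-t)) / t) +
      (-∫ t in Set.Ioi (0:ℝ),
        (ThetaDTm d n mt t - (∏ i, (n i : ℝ)) * Real.exp (-mt ^ 2 * t) *
          Real.exp (-2 * d * t) * (besselI0 (2 * t)) ^ d) / t) := by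
  have hL := aux_L d hmt
  have hlam : ∀ q : (∀ i : Fin d, Fin (n i)), IntegrableOn (fun t : ℝ =>
      (Real.exp (-lamDT d n mt q * t) - Real.exp (-t)) / t) (Set.Ioi 0) := fun q => by
    simpa using aux_integrable (lamDT_pos d n hmt q) one_pos
  have hS := integrable_finsetSum (μ := volume.restrict (Set.Ioi (0:ℝ))) Finset.univ
    (fun q _ => hlam q)
  have e : (fun t : ℝ =>
      (ThetaDTm d n mt t - (∏ i, (n i : ℝ)) * Real.exp (-mt ^ 2 * t) *
        Real.exp (-2 * d * t) * (besselI0 (2 * t)) ^ d) / t) = fun t : ℝ =>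
      (∑ q : (∀ i : Fin d, Fin (n i)), (Real.exp (-lamDT d n mt q * t) - Real.exp (-t)) / t) -
      (∏ i, (n i : ℝ)) * ((Real.exp (-mt ^ 2 * t) * Real.exp (-2 * d * t) *
        (besselI0 (2 * t)) ^ d - Real.exp (-t)) / t) := by
    funext t
    rw [← Finset.sum_div, Finset.sum_sub_distrib, Finset.sum_const, Finset.card_univ,
      Fintype.card_pi]
    simp only [Fintype.card_fin, nsmul_eq_mul, Nat.cast_prod, ThetaDTm]
    ring
  refine ⟨hL, ?_, ?_⟩
  · rw [e]
    exact hS.sub (hL.const_mul _)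
  · rw [e, integral_sub hS (hL.const_mul _), integral_const_mul,
      integral_finsetSum _ (fun q _ => hlam q)]
    simp only [aux_frullani (lamDT_pos d n hmt _), Finset.sum_neg_distrib]
    ring
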